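/- arXiv:2301.12929 — 2 statements merged into one kernel-verified Lean document; each statement's English description precedes it below -/
import Mathlib

section
/- Fix m⁺, m⁻ ∈ ℝ with m⁻ ≤ m⁺. Then PERM(N(m⁺, v⁺), N(m⁻, v⁻)) is monotone nondecreasing in the negative-score variance v⁻ and in the positive-score variance v⁺: if 0 < v₁ ≤ v₂ then PERM(N(m⁺, v⁺), N(m⁻, v₁)) ≤ PERM(N(m⁺, v⁺), N(m⁻, v₂)) and PERM(N(m⁺, v₁), N(m⁻, v⁻)) ≤ PERM(N(m⁺, v₂), N(m⁻, v⁻)) for any fixed v⁺, v⁻ > 0. -/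
open MeasureTheory ProbabilityTheory

/-- Expected rank of a score `a`: the mass the negative-score distribution puts above `a`. -/
noncomputable def ER (μn : Measure ℝ) (a : ℝ) : ENNReal := μn (Set.Ioi a)

/-- Proxy expected ranking metric. -/
noncomputable def PERM (μp μn : Measure ℝ) : ENNReal := ∫⁻ x, ER μn x ∂μp

theorem PERM_eq_conv_map_neg (μp μn : Measure ℝ) [SFinite μp] [SFinite μn] :
    PERM μp μn = (μp ∗ μn.map (fun x ↦ -x)) (Set.Iio 0) := by
  have hs : MeasurableSet ((fun p : ℝ × ℝ ↦ p.1 + p.2) ⁻¹' Set.Iio 0) :=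
    (by fun_prop : Measurable fun p : ℝ × ℝ ↦ p.1 + p.2) measurableSet_Iio
  rw [Measure.conv, Measure.map_apply (by fun_prop) measurableSet_Iio, Measure.prod_apply hs]
  refine lintegral_congr fun x ↦ ?_
  rw [ER, Measure.map_apply measurable_neg (measurable_prodMk_left hs)]
  congr 1
  ext y
  simp

theorem PERM_gaussianReal (mp mn : ℝ) (vp vn : NNReal) :
    PERM (gaussianReal mp vp) (gaussianReal mn vn) =
      gaussianReal (mp - mn) (vp + vn) (Set.Iio 0) := by
  rw [PERM_eq_conv_map_neg, gaussianReal_map_neg, gaussianReal_conv_gaussianReal, sub_eq_add_neg]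

theorem gaussianReal_eq_map_standard (m : ℝ) (v : NNReal) :
    gaussianReal m v = (gaussianReal 0 1).map (fun x ↦ m + √(v : ℝ) * x) := by
  have h : (fun x ↦ m + √(v : ℝ) * x) = (fun x ↦ m + x) ∘ (fun x ↦ √(v : ℝ) * x) := rfl
  rw [h, ← Measure.map_map (by fun_prop) (by fun_prop), gaussianReal_map_const_mul,
    gaussianReal_map_const_add]
  congr 1
  · simp
  · ext
    simp

theorem gaussianReal_Iio_zero_mono {m : ℝ} (hm : 0 ≤ m) :
    Monotone fun v : NNReal ↦ gaussianReal m v (Set.Iio 0) := by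
  intro v₁ v₂ hv
  dsimp only
  rw [gaussianReal_eq_map_standard m v₁, gaussianReal_eq_map_standard m v₂,
    Measure.map_apply (by fun_prop) measurableSet_Iio,
    Measure.map_apply (by fun_prop) measurableSet_Iio]
  refine measure_mono fun x hx ↦ ?_
  simp only [Set.mem_preimage, Set.mem_Iio] at hx ⊢
  have hsqrt : √(v₁ : ℝ) ≤ √(v₂ : ℝ) := Real.sqrt_le_sqrt (by exact_mod_cast hv)
  have hx_neg : x < 0 := by
    by_contra! h
    linarith [mul_nonneg (Real.sqrt_nonneg (v₁ : ℝ)) h]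
  linarith [mul_le_mul_of_nonpos_right hsqrt hx_neg.le]


theorem perm_monotone_in_variances_of_mean_le (mp mn : ℝ) (hm : mn ≤ mp)
    (v₁ v₂ : NNReal) (hv₁ : 0 < v₁) (hv₁₂ : v₁ ≤ v₂) :
    (∀ vp : NNReal, 0 < vp →
      PERM (gaussianReal mp vp) (gaussianReal mn v₁) ≤
        PERM (gaussianReal mp vp) (gaussianReal mn v₂)) ∧
    (∀ vn : NNReal, 0 < vn →
      PERM (gaussianReal mp v₁) (gaussianReal mn vn) ≤
        PERM (gaussianReal mp v₂) (gaussianReal mn vn)) := by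
  have hmono := gaussianReal_Iio_zero_mono (sub_nonneg.mpr hm)
  simp only [PERM_gaussianReal]
  exact ⟨fun vp _ ↦ hmono (by gcongr), fun vn _ ↦ hmono (by gcongr)⟩
end

section
/- (Monotone decreasing correspondence between KP and PERM, deviation below.) Fix m⁺ ∈ ℝ and v⁺, v⁻ > 0, and for m ∈ ℝ set KP(m) = W₂²(N(m⁺, v⁺), N(m, v⁻)) and P(m) = PERM(N(m⁺, v⁺), N(m, v⁻)). Then for all m₁, m₂ with m₁ ≤ m⁺ and m₂ ≤ m⁺: KP(m₁) ≤ KP(m₂) if and only if P(m₂) ≤ P(m₁). -/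
open MeasureTheory ProbabilityTheory

/-- `γ` is a coupling of `μ` and `ν`: its marginals are `μ` and `ν`. -/
def IsCoupling (γ : Measure (ℝ × ℝ)) (μ ν : Measure ℝ) : Prop :=
  γ.map Prod.fst = μ ∧ γ.map Prod.snd = ν

/-- Quadratic transport cost of a coupling, valued in `[0, ∞]`. -/
noncomputable def quadCost (γ : Measure (ℝ × ℝ)) : ENNReal :=
  ∫⁻ p, ENNReal.ofReal ((p.1 - p.2) ^ 2) ∂γ

/-- Squared 2-Wasserstein distance: infimum of the quadratic cost over couplings. -/
noncomputable def W2sq (μ ν : Measure ℝ) : ENNReal :=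
  ⨅ (γ : Measure (ℝ × ℝ)) (_ : IsCoupling γ μ ν), quadCost γ

theorem IsCoupling.W2sq_le {γ : Measure (ℝ × ℝ)} {μ ν : Measure ℝ} (h : IsCoupling γ μ ν) :
    W2sq μ ν ≤ quadCost γ :=
  iInf₂_le (f := fun γ (_ : IsCoupling γ μ ν) => quadCost γ) γ h

theorem IsCoupling.map_add_const {γ : Measure (ℝ × ℝ)} {μ ν : Measure ℝ} (h : IsCoupling γ μ ν)
    (c : ℝ) :
    IsCoupling (γ.map fun p : ℝ × ℝ => (p.1, p.2 + c)) μ (ν.map (· + c)) := by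
  have hT : Measurable fun p : ℝ × ℝ => (p.1, p.2 + c) := by fun_prop
  constructor
  · rw [Measure.map_map measurable_fst hT]
    exact h.1
  · rw [Measure.map_map measurable_snd hT, ← h.2, Measure.map_map (by fun_prop) measurable_snd]
    rfl

theorem IsCoupling.isProbabilityMeasure {γ : Measure (ℝ × ℝ)} {μ ν : Measure ℝ}
    [IsProbabilityMeasure μ] (h : IsCoupling γ μ ν) : IsProbabilityMeasure γ := by
  have : IsProbabilityMeasure (γ.map Prod.fst) := by rw [h.1]; infer_instance
  exact Measure.isProbabilityMeasure_of_map Prod.fst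

theorem IsCoupling.memLp_fst {γ : Measure (ℝ × ℝ)} {μ ν : Measure ℝ} (h : IsCoupling γ μ ν)
    (hμ : MemLp id 2 μ) : MemLp Prod.fst 2 γ :=
  MemLp.comp_of_map (g := id) (by rwa [h.1]) measurable_fst.aemeasurable

theorem IsCoupling.memLp_snd {γ : Measure (ℝ × ℝ)} {μ ν : Measure ℝ} (h : IsCoupling γ μ ν)
    (hν : MemLp id 2 ν) : MemLp Prod.snd 2 γ :=
  MemLp.comp_of_map (g := id) (by rwa [h.2]) measurable_snd.aemeasurable

theorem IsCoupling.integral_fst {γ : Measure (ℝ × ℝ)} {μ ν : Measure ℝ} (h : IsCoupling γ μ ν) :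
    ∫ p, p.1 ∂γ = ∫ x, x ∂μ := by
  rw [← h.1, integral_map measurable_fst.aemeasurable (by fun_prop)]

theorem IsCoupling.integral_snd {γ : Measure (ℝ × ℝ)} {μ ν : Measure ℝ} (h : IsCoupling γ μ ν) :
    ∫ p, p.2 ∂γ = ∫ y, y ∂ν := by
  rw [← h.2, integral_map measurable_snd.aemeasurable (by fun_prop)]

/-- The quadratic cost of a coupling with finite second moments is the Bochner integral. -/
theorem IsCoupling.quadCost_eq {γ : Measure (ℝ × ℝ)} {μ ν : Measure ℝ} (h : IsCoupling γ μ ν)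
    (hμ : MemLp id 2 μ) (hν : MemLp id 2 ν) :
    quadCost γ = ENNReal.ofReal (∫ p, (p.1 - p.2) ^ 2 ∂γ) :=
  (ofReal_integral_eq_lintegral_ofReal ((h.memLp_fst hμ).sub (h.memLp_snd hν)).integrable_sq
    (ae_of_all _ fun _ => sq_nonneg _)).symm

/-- Translating the second marginal changes the quadratic cost only through the means. -/
theorem IsCoupling.quadCost_map_add_const {γ : Measure (ℝ × ℝ)} {μ ν : Measure ℝ}
    [IsProbabilityMeasure μ] (h : IsCoupling γ μ ν) (hμ : MemLp id 2 μ) (hν : MemLp id 2 ν)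
    (c : ℝ) :
    quadCost (γ.map fun p : ℝ × ℝ => (p.1, p.2 + c)) +
        ENNReal.ofReal ((∫ x, x ∂μ - ∫ y, y ∂ν) ^ 2) =
      quadCost γ + ENNReal.ofReal ((∫ x, x ∂μ - ∫ y, y ∂ν - c) ^ 2) := by
  have := h.isProbabilityMeasure
  have hf := h.memLp_fst hμ
  have hs := h.memLp_snd hν
  have hd := hf.sub hs
  have hi : Integrable (fun p : ℝ × ℝ => p.1 - p.2) γ := hd.integrable (by norm_num)
  have hq : Integrable (fun p : ℝ × ℝ => (p.1 - p.2) ^ 2) γ := hd.integrable_sq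
  have hq' : Integrable (fun p : ℝ × ℝ => (p.1 - (p.2 + c)) ^ 2) γ :=
    (hf.sub (hs.add (memLp_const c))).integrable_sq
  have hT : Measurable fun p : ℝ × ℝ => (p.1, p.2 + c) := by fun_prop
  have hcost : quadCost (γ.map fun p : ℝ × ℝ => (p.1, p.2 + c)) =
      ENNReal.ofReal (∫ p, (p.1 - (p.2 + c)) ^ 2 ∂γ) := by
    rw [quadCost, lintegral_map (by fun_prop) hT,
      ofReal_integral_eq_lintegral_ofReal hq' (ae_of_all _ fun _ => sq_nonneg _)]
  have hmean : ∫ p, (p.1 - p.2) ∂γ = ∫ x, x ∂μ - ∫ y, y ∂ν := by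
    rw [integral_sub (hf.integrable (by norm_num)) (hs.integrable (by norm_num)),
      h.integral_fst, h.integral_snd]
  have hexp : ∫ p, (p.1 - (p.2 + c)) ^ 2 ∂γ =
      ∫ p, (p.1 - p.2) ^ 2 ∂γ - 2 * c * (∫ x, x ∂μ - ∫ y, y ∂ν) + c ^ 2 := by
    have hpt : (fun p : ℝ × ℝ => (p.1 - (p.2 + c)) ^ 2) =
        fun p => (p.1 - p.2) ^ 2 - 2 * c * (p.1 - p.2) + c ^ 2 := by
      ext p; ring
    have hsub : Integrable (fun p : ℝ × ℝ => (p.1 - p.2) ^ 2 - 2 * c * (p.1 - p.2)) γ :=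
      hq.sub (hi.const_mul _)
    rw [hpt, integral_add hsub (integrable_const _),
      integral_sub hq (hi.const_mul _), integral_const_mul, hmean]
    simp
  rw [hcost, h.quadCost_eq hμ hν,
    ← ENNReal.ofReal_add (integral_nonneg fun _ => sq_nonneg _) (sq_nonneg _),
    ← ENNReal.ofReal_add (integral_nonneg fun _ => sq_nonneg _) (sq_nonneg _), hexp]
  congr 1
  ring

theorem W2sq_map_add_const_add_le {μ ν : Measure ℝ} [IsProbabilityMeasure μ]
    (hμ : MemLp id 2 μ) (hν : MemLp id 2 ν) (c : ℝ) :
    W2sq μ (ν.map (· + c)) + ENNReal.ofReal ((∫ x, x ∂μ - ∫ y, y ∂ν) ^ 2) ≤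
      W2sq μ ν + ENNReal.ofReal ((∫ x, x ∂μ - ∫ y, y ∂ν - c) ^ 2) := by
  conv_rhs => rw [W2sq]
  simp only [ENNReal.iInf_add]
  refine le_iInf₂ fun γ hγ => ?_
  rw [← hγ.quadCost_map_add_const hμ hν c]
  gcongr
  exact (hγ.map_add_const c).W2sq_le

theorem W2sq_ne_top {μ ν : Measure ℝ} [IsProbabilityMeasure μ] [IsProbabilityMeasure ν]
    (hμ : MemLp id 2 μ) (hν : MemLp id 2 ν) : W2sq μ ν ≠ ⊤ := by
  have h : IsCoupling (μ.prod ν) μ ν := ⟨by simp, by simp⟩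
  refine ne_top_of_le_ne_top ?_ h.W2sq_le
  rw [h.quadCost_eq hμ hν]
  exact ENNReal.ofReal_ne_top

/-- Moving a Gaussian towards a fixed one from below strictly decreases the distance. -/
theorem strictAntiOn_W2sq_gaussianReal (mp : ℝ) (vp vn : NNReal) :
    StrictAntiOn (fun m => W2sq (gaussianReal mp vp) (gaussianReal m vn)) (Set.Iic mp) := by
  intro m _ m' hm' hlt
  have hp : MemLp id 2 (gaussianReal mp vp) := memLp_id_gaussianReal 2
  have hn : MemLp id 2 (gaussianReal m vn) := memLp_id_gaussianReal 2
  have key := W2sq_map_add_const_add_le hp hn (m' - m)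
  rw [gaussianReal_map_add_const, integral_id_gaussianReal, integral_id_gaussianReal,
    add_sub_cancel, sub_sub_sub_cancel_right] at key
  have hsq : ENNReal.ofReal ((mp - m') ^ 2) < ENNReal.ofReal ((mp - m) ^ 2) := by
    have : m' ≤ mp := hm'
    rw [ENNReal.ofReal_lt_ofReal_iff (by nlinarith)]
    nlinarith
  have hlt' := key.trans_lt (ENNReal.add_lt_add_left (W2sq_ne_top hp hn) hsq)
  exact lt_of_add_lt_add_right hlt'

theorem ER_gaussianReal (m : ℝ) (v : NNReal) (a : ℝ) :
    ER (gaussianReal m v) a = gaussianReal 0 v (Set.Ioi (a - m)) := by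
  have h := gaussianReal_map_add_const (μ := 0) (v := v) m
  rw [zero_add] at h
  rw [ER, ← h, Measure.map_apply (by fun_prop) measurableSet_Ioi]
  congr 1
  ext x
  simp [sub_lt_iff_lt_add]

theorem strictMono_ER_gaussianReal {v : NNReal} (hv : v ≠ 0) (a : ℝ) :
    StrictMono fun m => ER (gaussianReal m v) a := by
  intro m m' hlt
  simp only [ER_gaussianReal]
  have hlt' : a - m' < a - m := by linarith
  have hpos : gaussianReal 0 v (Set.Ioc (a - m') (a - m)) ≠ 0 := fun h0 => by
    have := gaussianReal_absolutelyContinuous' 0 hv h0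
    simp at this
    linarith
  rw [← Set.Ioc_union_Ioi_eq_Ioi hlt'.le,
    measure_union (Set.Ioc_disjoint_Ioi le_rfl) measurableSet_Ioi, add_comm]
  exact ENNReal.lt_add_right (measure_ne_top _ _) hpos

theorem antitone_ER (μ : Measure ℝ) : Antitone (ER μ) := fun _ _ h =>
  measure_mono (Set.Ioi_subset_Ioi h)

theorem strictMono_PERM_gaussianReal (μ : Measure ℝ) [IsProbabilityMeasure μ] {v : NNReal}
    (hv : v ≠ 0) : StrictMono fun m => PERM μ (gaussianReal m v) := by
  intro m m' hlt
  refine lintegral_strict_mono (NeZero.ne μ) (antitone_ER _).measurable.aemeasurable ?_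
    (ae_of_all _ fun a => strictMono_ER_gaussianReal hv a hlt)
  refine ne_top_of_le_ne_top ENNReal.one_ne_top ?_
  calc ∫⁻ x, ER (gaussianReal m v) x ∂μ ≤ ∫⁻ _, 1 ∂μ := lintegral_mono fun _ => prob_le_one
    _ = 1 := by simp

theorem kp_perm_antitone_correspondence_below (mp : ℝ) (vp vn : NNReal)
    (hvp : 0 < vp) (hvn : 0 < vn) (m₁ m₂ : ℝ) (h₁ : m₁ ≤ mp) (h₂ : m₂ ≤ mp) :
    W2sq (gaussianReal mp vp) (gaussianReal m₁ vn) ≤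
        W2sq (gaussianReal mp vp) (gaussianReal m₂ vn) ↔
      PERM (gaussianReal mp vp) (gaussianReal m₂ vn) ≤
        PERM (gaussianReal mp vp) (gaussianReal m₁ vn) := by
  rw [(strictAntiOn_W2sq_gaussianReal mp vp vn).le_iff_ge h₁ h₂,
    (strictMono_PERM_gaussianReal (gaussianReal mp vp) hvn.ne').le_iff_le]
end
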